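/- arXiv:2102.04295 — 7 statements merged into one kernel-verified Lean document; each statement's English description precedes it below -/
import Mathlib

section
/- Let n ≥ 1, let A be an invertible n×n real matrix, let Σ_X and Σ_Y be symmetric positive definite n×n real matrices, and let σ > 0. Define Δ = ((σ²/4)·A⁻¹Σ_X⁻¹A⁻* + Σ_Y)^{1/2}, T = Δ(ΔA*Σ_X A Δ)^{-1/2}ΔA* − (σ/2)A⁻¹Σ_X⁻¹, and Σ_{Y|X} = σΔ(ΔA*Σ_X A Δ)^{-1/2}Δ − (σ²/2)A⁻¹Σ_X⁻¹A⁻*. Then T Σ_X T* + Σ_{Y|X} = Σ_Y. -/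
open Matrix

/-- Second verification step in Theorem 1 of Bojilov–Galichon:
with `Δ = ((σ²/4)·A⁻¹Sx⁻¹A⁻ᵀ + Sy)^{1/2}` (encoded as the unique positive
semidefinite square root `Δ`), `S = (ΔAᵀSx A Δ)^{1/2}`,
`T = Δ S⁻¹ Δ Aᵀ − (σ/2) A⁻¹Sx⁻¹` and
`SYX = σ Δ S⁻¹ Δ − (σ²/2) A⁻¹Sx⁻¹A⁻ᵀ`, one has `T Sx Tᵀ + SYX = Sy`.
Here `Sx, Sy` play the roles of `Σ_X, Σ_Y`, and `SYX` that of `Σ_{Y|X}`. -/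
theorem stmt1 (n : ℕ) (hn : 1 ≤ n)
    (A Sx Sy : Matrix (Fin n) (Fin n) ℝ)
    (hA : IsUnit A.det) (hX : Sx.PosDef) (hY : Sy.PosDef)
    (σ : ℝ) (hσ : 0 < σ)
    (Δ : Matrix (Fin n) (Fin n) ℝ) (hΔ : Δ.PosSemidef)
    (hΔ2 : Δ * Δ = (σ ^ 2 / 4) • (A⁻¹ * Sx⁻¹ * (Aᵀ)⁻¹) + Sy)
    (S : Matrix (Fin n) (Fin n) ℝ) (hS : S.PosSemidef)
    (hS2 : S * S = Δ * Aᵀ * Sx * A * Δ)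
    (T SYX : Matrix (Fin n) (Fin n) ℝ)
    (hT : T = Δ * S⁻¹ * Δ * Aᵀ - (σ / 2) • (A⁻¹ * Sx⁻¹))
    (hYX : SYX = σ • (Δ * S⁻¹ * Δ) - (σ ^ 2 / 2) • (A⁻¹ * Sx⁻¹ * (Aᵀ)⁻¹)) :
    T * Sx * Tᵀ + SYX = Sy := by
  have hXd : IsUnit Sx.det := hX.det_pos.ne'.isUnit
  have hXt : Sxᵀ = Sx := by simpa using hX.isHermitian.eq
  have hΔt : Δᵀ = Δ := by simpa using hΔ.isHermitian.eq
  have hSt : Sᵀ = S := by simpa using hS.isHermitian.eq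
  have hAt : IsUnit (Aᵀ).det := by simpa using hA
  have hP : (A⁻¹ * Sx⁻¹ * (Aᵀ)⁻¹).PosSemidef := by
    have h := hX.inv.posSemidef.mul_mul_conjTranspose_same A⁻¹
    rwa [conjTranspose_eq_transpose_of_trivial, transpose_nonsing_inv] at h
  have hD : (Δ * Δ).PosDef := by
    rw [hΔ2]
    exact PosDef.posSemidef_add (hP.smul (by positivity)) hY
  have hDd : Δ.det ≠ 0 := by
    intro h
    have := hD.det_pos
    simp [h] at this
  have hSd : IsUnit S.det := by
    have h := congrArg det hS2
    simp only [det_mul, det_transpose] at h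
    refine isUnit_iff_ne_zero.mpr fun h0 => ?_
    rw [h0, zero_mul] at h
    have := hA.ne_zero
    have := hXd.ne_zero
    have h2 : Δ.det * A.det * Sx.det * A.det * Δ.det ≠ 0 := by positivity
    exact h2 h.symm
  have hTt : Tᵀ = A * (Δ * S⁻¹ * Δ) - (σ / 2) • (Sx⁻¹ * (Aᵀ)⁻¹) := by
    rw [hT]
    simp only [transpose_sub, transpose_mul, transpose_smul, transpose_nonsing_inv, hXt, hΔt, hSt,
      transpose_transpose, Matrix.mul_assoc]
  have h1 : (Δ * S⁻¹ * Δ * Aᵀ) * Sx * (A * (Δ * S⁻¹ * Δ)) = Δ * Δ := by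
    calc _ = Δ * S⁻¹ * (Δ * Aᵀ * Sx * A * Δ) * S⁻¹ * Δ := by simp only [Matrix.mul_assoc]
      _ = Δ * (S⁻¹ * S) * (S * S⁻¹) * Δ := by rw [← hS2]; simp only [Matrix.mul_assoc]
      _ = _ := by rw [nonsing_inv_mul _ hSd, mul_nonsing_inv _ hSd]; simp
  have h2 : (Δ * S⁻¹ * Δ * Aᵀ) * Sx * (Sx⁻¹ * (Aᵀ)⁻¹) = Δ * S⁻¹ * Δ := by
    rw [Matrix.mul_assoc _ Sx, mul_nonsing_inv_cancel_left _ _ hXd,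
      mul_nonsing_inv_cancel_right _ _ hAt]
  have h3 : (A⁻¹ * Sx⁻¹) * Sx * (A * (Δ * S⁻¹ * Δ)) = Δ * S⁻¹ * Δ := by
    rw [nonsing_inv_mul_cancel_right _ _ hXd, nonsing_inv_mul_cancel_left _ _ hA]
  have h4 : (A⁻¹ * Sx⁻¹) * Sx * (Sx⁻¹ * (Aᵀ)⁻¹) = A⁻¹ * Sx⁻¹ * (Aᵀ)⁻¹ := by
    rw [nonsing_inv_mul_cancel_right _ _ hXd, Matrix.mul_assoc]
  have h5 : Sy = Δ * Δ - (σ ^ 2 / 4) • (A⁻¹ * Sx⁻¹ * (Aᵀ)⁻¹) := by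
    rw [hΔ2]; abel
  rw [hTt, hYX, hT, h5]
  simp only [Matrix.sub_mul, Matrix.mul_sub, Matrix.smul_mul, Matrix.mul_smul, h1, h2, h3, h4]
  module
end

section
/- Let n ≥ 1, let A be an invertible n×n real matrix, let Σ_X and Σ_Y be symmetric positive definite n×n real matrices, and let σ > 0. Define Δ = ((σ²/4)·A⁻¹Σ_X⁻¹A⁻* + Σ_Y)^{1/2}. Then the matrix Σ_{Y|X} = σΔ(ΔA*Σ_X A Δ)^{-1/2}Δ − (σ²/2)A⁻¹Σ_X⁻¹A⁻* is symmetric positive definite. -/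
open Matrix

/-- In Theorem 1 of Bojilov–Galichon, the conditional covariance
matrix `SYX = σ Δ (Δ Aᵀ Sx A Δ)^{-1/2} Δ − (σ²/2) A⁻¹Sx⁻¹A⁻ᵀ`, where
`Δ = ((σ²/4)·A⁻¹Sx⁻¹A⁻ᵀ + Sy)^{1/2}`, is symmetric positive definite.
Square roots are encoded as the unique positive semidefinite square roots
(`Δ` and `S`), and `M^{-1/2}` as `S⁻¹`. -/
theorem stmt2 (n : ℕ) (hn : 1 ≤ n)
    (A Sx Sy : Matrix (Fin n) (Fin n) ℝ)
    (hA : IsUnit A.det) (hX : Sx.PosDef) (hY : Sy.PosDef)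
    (σ : ℝ) (hσ : 0 < σ)
    (Δ : Matrix (Fin n) (Fin n) ℝ) (hΔ : Δ.PosSemidef)
    (hΔ2 : Δ * Δ = (σ ^ 2 / 4) • (A⁻¹ * Sx⁻¹ * (Aᵀ)⁻¹) + Sy)
    (S : Matrix (Fin n) (Fin n) ℝ) (hS : S.PosSemidef)
    (hS2 : S * S = Δ * Aᵀ * Sx * A * Δ) :
    (σ • (Δ * S⁻¹ * Δ) - (σ ^ 2 / 2) • (A⁻¹ * Sx⁻¹ * (Aᵀ)⁻¹)).PosDef := by
  have posDef_of_eig : ∀ (c : ℝ), 0 < c → (S * S - (c ^ 2) • (1 : Matrix (Fin n) (Fin n) ℝ)).PosDef →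
      (S - c • (1 : Matrix (Fin n) (Fin n) ℝ)).PosDef := by
    intro c hc hK
    have hH : (S - c • (1 : Matrix (Fin n) (Fin n) ℝ)).IsHermitian := by
      have h1 : Sᵀ = S := hS.1
      simp [Matrix.IsHermitian, h1]
    rw [hH.posDef_iff_eigenvalues_pos]
    intro i
    have hv := hH.mulVec_eigenvectorBasis i
    have hne : (hH.eigenvectorBasis i).ofLp ≠ 0 := by
      intro h
      have := hH.eigenvectorBasis.orthonormal.ne_zero i
      exact this ((WithLp.ofLp_eq_zero 2).1 h)
    generalize hH.eigenvalues i = l at hv ⊢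
    generalize (hH.eigenvectorBasis i).ofLp = v at hv hne
    have hSv : S *ᵥ v = (l + c) • v := by
      rw [Matrix.sub_mulVec, Matrix.smul_mulVec, Matrix.one_mulVec] at hv
      rw [add_smul, ← hv]; abel
    have hvv : 0 < v ⬝ᵥ v := by
      have := Matrix.PosDef.one (n := Fin n) (R := ℝ) |>.dotProduct_mulVec_pos hne
      simpa using this
    have h1 := hK.dotProduct_mulVec_pos hne
    have h2 := hS.dotProduct_mulVec_nonneg v
    rw [Matrix.sub_mulVec, Matrix.smul_mulVec, Matrix.one_mulVec, ← Matrix.mulVec_mulVec, hSv,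
      Matrix.mulVec_smul, hSv] at h1
    rw [hSv] at h2
    simp only [star_trivial, dotProduct_sub, dotProduct_smul, smul_eq_mul] at h1 h2
    have h3 : 0 ≤ l + c := nonneg_of_mul_nonneg_left h2 hvv
    have h4 : 0 < ((l + c) ^ 2 - c ^ 2) := by
      refine pos_of_mul_pos_left (b := v ⬝ᵥ v) ?_ hvv.le
      nlinarith
    nlinarith
  have hAT : IsUnit (Aᵀ).det := by rwa [Matrix.det_transpose]
  have hXd : IsUnit Sx.det := hX.det_pos.ne'.isUnit
  have hQ : (A⁻¹ * Sx⁻¹ * (Aᵀ)⁻¹).PosSemidef := by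
    have := hX.inv.posSemidef.mul_mul_conjTranspose_same A⁻¹
    rwa [Matrix.conjTranspose_nonsing_inv, Matrix.conjTranspose_eq_transpose_of_trivial] at this
  have hD2 : (Δ * Δ).PosDef := by
    rw [hΔ2]
    exact Matrix.PosDef.posSemidef_add (hQ.smul (by positivity)) hY
  have hDd : IsUnit Δ.det := by
    have := hD2.det_pos.ne'
    rw [Matrix.det_mul] at this
    exact (left_ne_zero_of_mul this).isUnit
  have hSd : IsUnit S.det := by
    have : IsUnit (S * S).det := by
      rw [hS2]; simp only [Matrix.det_mul]
      exact (((hDd.mul hAT).mul hXd).mul hA).mul hDd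
    rw [Matrix.det_mul] at this
    exact isUnit_of_mul_isUnit_left this
  have hSS : S⁻¹ * S⁻¹ = Δ⁻¹ * (A⁻¹ * Sx⁻¹ * (Aᵀ)⁻¹) * Δ⁻¹ := by
    rw [← Matrix.mul_inv_rev, hS2]
    simp only [Matrix.mul_inv_rev, Matrix.mul_assoc]
  generalize A⁻¹ * Sx⁻¹ * (Aᵀ)⁻¹ = Q at *
  have hDi : (Δ⁻¹)ᴴ = Δ⁻¹ := by rw [Matrix.conjTranspose_nonsing_inv, hΔ.1.eq]
  have hSi : (S⁻¹)ᴴ = S⁻¹ := by rw [Matrix.conjTranspose_nonsing_inv, hS.1.eq]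
  have e1 : Δ * Δ⁻¹ = 1 := Matrix.mul_nonsing_inv _ hDd
  have e2 : Δ⁻¹ * Δ = 1 := Matrix.nonsing_inv_mul _ hDd
  have e3 : S * S⁻¹ = 1 := Matrix.mul_nonsing_inv _ hSd
  have e4 : S⁻¹ * S = 1 := Matrix.nonsing_inv_mul _ hSd
  have hQe : Q = Δ * S⁻¹ * (S⁻¹ * Δ) := by
    calc Q = (Δ * Δ⁻¹) * Q * (Δ⁻¹ * Δ) := by rw [e1, e2]; simp
      _ = Δ * (Δ⁻¹ * Q * Δ⁻¹) * Δ := by simp only [Matrix.mul_assoc]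
      _ = _ := by rw [← hSS]; simp only [Matrix.mul_assoc]
  have hK : (S * S - ((σ / 2) ^ 2) • (1 : Matrix (Fin n) (Fin n) ℝ)).PosDef := by
    have hu : IsUnit (S * Δ⁻¹) := by
      rw [Matrix.isUnit_iff_isUnit_det, Matrix.det_mul]
      exact hSd.mul (Matrix.isUnit_nonsing_inv_det _ hDd)
    have h := (Matrix.IsUnit.posDef_star_right_conjugate_iff hu).2 hY
    have hs : star (S * Δ⁻¹) = Δ⁻¹ * S := by
      rw [Matrix.star_eq_conjTranspose, Matrix.conjTranspose_mul, hDi, hS.1.eq]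
    rw [hs, eq_sub_of_add_eq' hΔ2.symm] at h
    convert h using 1
    rw [Matrix.mul_sub, Matrix.sub_mul, Matrix.mul_smul, Matrix.smul_mul]
    have a1 : S * Δ⁻¹ * (Δ * Δ) * (Δ⁻¹ * S) = S * S := by
      calc _ = S * (Δ⁻¹ * Δ) * (Δ * Δ⁻¹) * S := by simp only [Matrix.mul_assoc]
        _ = _ := by rw [e1, e2]; simp
    have a2 : S * Δ⁻¹ * Q * (Δ⁻¹ * S) = 1 := by
      calc _ = S * (Δ⁻¹ * Q * Δ⁻¹) * S := by simp only [Matrix.mul_assoc]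
        _ = (S * S⁻¹) * (S⁻¹ * S) := by rw [← hSS]; simp only [Matrix.mul_assoc]
        _ = 1 := by rw [e3, e4]; simp
    rw [a1, a2]; congr 2; ring
  have hu : IsUnit (Δ * S⁻¹) := by
    rw [Matrix.isUnit_iff_isUnit_det, Matrix.det_mul]
    exact hDd.mul (Matrix.isUnit_nonsing_inv_det _ hSd)
  have h := (Matrix.IsUnit.posDef_star_right_conjugate_iff hu).2
    (posDef_of_eig (σ / 2) (by positivity) hK)
  have hs : star (Δ * S⁻¹) = S⁻¹ * Δ := by
    rw [Matrix.star_eq_conjTranspose, Matrix.conjTranspose_mul, hSi, hΔ.1.eq]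
  rw [hs] at h
  convert h.smul hσ using 1
  rw [Matrix.mul_sub, Matrix.sub_mul, Matrix.mul_smul, Matrix.smul_mul, Matrix.mul_one, ← hQe,
    smul_sub, smul_smul]
  congr 2
  · calc Δ * S⁻¹ * Δ = Δ * (S⁻¹ * S) * S⁻¹ * Δ := by rw [e4]; simp
      _ = _ := by simp only [Matrix.mul_assoc]
  · ring
end

section
/- Let n ≥ 1, let A be an invertible n×n real matrix, let Σ_X and Σ_Y be symmetric positive definite n×n real matrices, and let σ > 0. Define Δ = ((σ²/4)·A⁻¹Σ_X⁻¹A⁻* + Σ_Y)^{1/2} and Σ_XY = Σ_X A Δ(ΔA*Σ_X A Δ)^{-1/2}Δ − (σ/2)A⁻*. Then Σ_XY satisfies the quadratic matrix equation Σ_XY* Σ_X⁻¹ Σ_XY + σ·A⁻¹Σ_X⁻¹Σ_XY − Σ_Y = 0. -/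
open Matrix

/-- In Theorem 1(ii) of Bojilov–Galichon, the closed-form
cross-covariance matrix `Sxy = Sx A Δ (Δ Aᵀ Sx A Δ)^{-1/2} Δ − (σ/2) A⁻ᵀ`,
with `Δ = ((σ²/4)·A⁻¹Sx⁻¹A⁻ᵀ + Sy)^{1/2}`, satisfies the quadratic matrix
equation `Sxyᵀ Sx⁻¹ Sxy + σ·A⁻¹Sx⁻¹Sxy − Sy = 0`.  Square roots are encoded as
the unique positive semidefinite square roots (`Δ` and `S`), with
`M^{-1/2} = S⁻¹`. -/
theorem stmt3 (n : ℕ) (hn : 1 ≤ n)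
    (A Sx Sy : Matrix (Fin n) (Fin n) ℝ)
    (hA : IsUnit A.det) (hX : Sx.PosDef) (hY : Sy.PosDef)
    (σ : ℝ) (hσ : 0 < σ)
    (Δ : Matrix (Fin n) (Fin n) ℝ) (hΔ : Δ.PosSemidef)
    (hΔ2 : Δ * Δ = (σ ^ 2 / 4) • (A⁻¹ * Sx⁻¹ * (Aᵀ)⁻¹) + Sy)
    (S : Matrix (Fin n) (Fin n) ℝ) (hS : S.PosSemidef)
    (hS2 : S * S = Δ * Aᵀ * Sx * A * Δ)
    (Sxy : Matrix (Fin n) (Fin n) ℝ)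
    (hSxy : Sxy = Sx * A * Δ * S⁻¹ * Δ - (σ / 2) • (Aᵀ)⁻¹) :
    Sxyᵀ * Sx⁻¹ * Sxy + σ • (A⁻¹ * Sx⁻¹ * Sxy) - Sy = 0 := by
  have hXd : IsUnit Sx.det := hX.det_pos.ne'.isUnit
  have hAt : IsUnit Aᵀ.det := by rwa [det_transpose]
  have hXt : Sxᵀ = Sx := by simpa using hX.isHermitian.eq
  have hΔt : Δᵀ = Δ := by simpa using hΔ.isHermitian.eq
  have hSt : Sᵀ = S := by simpa using hS.isHermitian.eq
  have hQ : (A⁻¹ * Sx⁻¹ * (Aᵀ)⁻¹).PosSemidef := by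
    have h := hX.inv.posSemidef.mul_mul_conjTranspose_same A⁻¹
    rwa [conjTranspose_eq_transpose_of_trivial, transpose_nonsing_inv] at h
  have hD2 : (Δ * Δ).PosDef := by
    rw [hΔ2]
    exact PosDef.posSemidef_add (hQ.smul (by positivity)) hY
  have hΔd : IsUnit Δ.det := by
    have h := hD2.det_pos.ne'.isUnit
    rw [det_mul] at h
    exact isUnit_of_mul_isUnit_left h
  have hSd : IsUnit S.det := by
    have h : IsUnit (S * S).det := by
      rw [hS2]
      simp only [det_mul]
      exact (((hΔd.mul hAt).mul hXd).mul hA).mul hΔd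
    rw [det_mul] at h
    exact isUnit_of_mul_isUnit_left h
  obtain ⟨Z, hZ⟩ : ∃ Z, Z = Δ * S⁻¹ * Δ := ⟨_, rfl⟩
  have hZt : Zᵀ = Z := by
    rw [hZ]
    simp [transpose_mul, transpose_nonsing_inv, hΔt, hSt, Matrix.mul_assoc]
  have hZZ : Z * Aᵀ * Sx * A * Z = Δ * Δ := by
    calc Z * Aᵀ * Sx * A * Z = Δ * S⁻¹ * (Δ * Aᵀ * Sx * A * Δ) * S⁻¹ * Δ := by
          rw [hZ]; simp only [Matrix.mul_assoc]
      _ = Δ * Δ := by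
          rw [← hS2, ← Matrix.mul_assoc, nonsing_inv_mul_cancel_right _ _ hSd,
            mul_nonsing_inv_cancel_right _ _ hSd]
  have h1 : Sxy = Sx * A * Z - (σ / 2) • (Aᵀ)⁻¹ := by
    rw [hSxy, hZ]; simp only [Matrix.mul_assoc]
  have h2 : Sxyᵀ = Z * Aᵀ * Sx - (σ / 2) • A⁻¹ := by
    rw [h1]
    simp [transpose_mul, transpose_nonsing_inv, hZt, hXt, Matrix.mul_assoc]
  have h3 : Sx⁻¹ * Sxy = A * Z - (σ / 2) • (Sx⁻¹ * (Aᵀ)⁻¹) := by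
    rw [h1, Matrix.mul_sub, Matrix.mul_assoc, nonsing_inv_mul_cancel_left _ _ hXd,
      Matrix.mul_smul]
  have h4 : A⁻¹ * (A * Z) = Z := nonsing_inv_mul_cancel_left _ _ hA
  have h5 : Z * Aᵀ * Sx * (Sx⁻¹ * (Aᵀ)⁻¹) = Z := by
    rw [← Matrix.mul_assoc, mul_nonsing_inv_cancel_right _ _ hXd,
      mul_nonsing_inv_cancel_right _ _ hAt]
  have h6 : Z * Aᵀ * Sx * (A * Z) = Δ * Δ := by rw [← hZZ]; simp only [Matrix.mul_assoc]
  have h7 : Sy = Δ * Δ - (σ ^ 2 / 4) • (A⁻¹ * (Sx⁻¹ * (Aᵀ)⁻¹)) := by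
    rw [hΔ2, Matrix.mul_assoc]; abel
  rw [Matrix.mul_assoc, Matrix.mul_assoc, h3, h2, h7]
  simp only [Matrix.sub_mul, Matrix.mul_sub, Matrix.smul_mul, Matrix.mul_smul, h4, h5, h6]
  module
end

section
/- Let n ≥ 1, let A be an invertible n×n real matrix, let Σ_X and Σ_Y be symmetric positive definite n×n real matrices, and let σ > 0. Define Δ = ((σ²/4)·A⁻¹Σ_X⁻¹A⁻* + Σ_Y)^{1/2} and Σ_XY = Σ_X A Δ(ΔA*Σ_X A Δ)^{-1/2}Δ − (σ/2)A⁻*. Then Σ_XY is invertible, Σ_Y Σ_XY⁻¹ Σ_X − Σ_XY* is invertible, and σ·(Σ_Y Σ_XY⁻¹ Σ_X − Σ_XY*)⁻¹ = A. -/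
open Matrix

/-- The identification formula of Theorem 2 of
Bojilov–Galichon exactly inverts the closed-form equilibrium cross-covariance
of Theorem 1: with `Δ = ((σ²/4)·A⁻¹Sx⁻¹A⁻ᵀ + Sy)^{1/2}` and
`Sxy = Sx A Δ (Δ Aᵀ Sx A Δ)^{-1/2} Δ − (σ/2) A⁻ᵀ`, the matrices `Sxy` and
`Sy Sxy⁻¹ Sx − Sxyᵀ` are invertible and `σ·(Sy Sxy⁻¹ Sx − Sxyᵀ)⁻¹ = A`.
Square roots are encoded as the unique positive semidefinite square roots
(`Δ` and `S`), with `M^{-1/2} = S⁻¹`. -/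
theorem stmt8 (n : ℕ) (hn : 1 ≤ n)
    (A Sx Sy : Matrix (Fin n) (Fin n) ℝ)
    (hA : IsUnit A.det) (hX : Sx.PosDef) (hY : Sy.PosDef)
    (σ : ℝ) (hσ : 0 < σ)
    (Δ : Matrix (Fin n) (Fin n) ℝ) (hΔ : Δ.PosSemidef)
    (hΔ2 : Δ * Δ = (σ ^ 2 / 4) • (A⁻¹ * Sx⁻¹ * (Aᵀ)⁻¹) + Sy)
    (S : Matrix (Fin n) (Fin n) ℝ) (hS : S.PosSemidef)
    (hS2 : S * S = Δ * Aᵀ * Sx * A * Δ)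
    (Sxy : Matrix (Fin n) (Fin n) ℝ)
    (hSxy : Sxy = Sx * A * Δ * S⁻¹ * Δ - (σ / 2) • (Aᵀ)⁻¹) :
    IsUnit Sxy.det ∧ IsUnit (Sy * Sxy⁻¹ * Sx - Sxyᵀ).det ∧
      σ • (Sy * Sxy⁻¹ * Sx - Sxyᵀ)⁻¹ = A := by
  have hAi : A * A⁻¹ = 1 := mul_nonsing_inv _ hA
  have hAi' : A⁻¹ * A = 1 := nonsing_inv_mul _ hA
  have hAt : IsUnit (Aᵀ).det := by rwa [det_transpose]
  have hBi : Aᵀ * (Aᵀ)⁻¹ = 1 := mul_nonsing_inv _ hAt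
  have hBi' : (Aᵀ)⁻¹ * Aᵀ = 1 := nonsing_inv_mul _ hAt
  have hXu : IsUnit Sx.det := hX.det_pos.ne'.isUnit
  have hYu : IsUnit Sy.det := hY.det_pos.ne'.isUnit
  have hXi' : Sx⁻¹ * Sx = 1 := nonsing_inv_mul _ hXu
  have hΔt : Δᵀ = Δ := by simpa [conjTranspose_eq_transpose_of_trivial] using hΔ.1.eq
  have hSt : Sᵀ = S := by simpa [conjTranspose_eq_transpose_of_trivial] using hS.1.eq
  have hXt : Sxᵀ = Sx := by simpa [conjTranspose_eq_transpose_of_trivial] using hX.1.eq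
  have hW : (A⁻¹ * Sx⁻¹ * (Aᵀ)⁻¹).PosSemidef := by
    have := hX.inv.posSemidef.mul_mul_conjTranspose_same A⁻¹
    simpa [conjTranspose_eq_transpose_of_trivial, transpose_nonsing_inv] using this
  have hDD : (Δ * Δ).PosDef := by
    rw [hΔ2]
    exact Matrix.PosDef.posSemidef_add (hW.smul (by positivity)) hY
  have hΔu : IsUnit Δ.det := by
    have h := hDD.det_pos.ne'
    rw [det_mul] at h
    exact (left_ne_zero_of_mul h).isUnit
  have hSu : IsUnit S.det := by
    have h : IsUnit (S * S).det := by
      rw [hS2]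
      simp only [det_mul]
      exact (((hΔu.mul hAt).mul hXu).mul hA).mul hΔu
    rw [det_mul] at h
    exact isUnit_of_mul_isUnit_left h
  have hSi : S * S⁻¹ = 1 := mul_nonsing_inv _ hSu
  have hSi' : S⁻¹ * S = 1 := nonsing_inv_mul _ hSu
  obtain ⟨T, hT⟩ : ∃ T, T = Δ * S⁻¹ * Δ := ⟨_, rfl⟩
  have hTt : Tᵀ = T := by
    rw [hT]
    simp only [transpose_mul, transpose_nonsing_inv, hΔt, hSt, Matrix.mul_assoc]
  have hQ : Sxy = Sx * A * T - (σ / 2) • (Aᵀ)⁻¹ := by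
    rw [hSxy, hT]; simp only [Matrix.mul_assoc]
  have hTMT : T * Aᵀ * Sx * A * T = Δ * Δ := by
    calc T * Aᵀ * Sx * A * T = Δ * S⁻¹ * (Δ * Aᵀ * Sx * A * Δ) * S⁻¹ * Δ := by
          rw [hT]; simp only [Matrix.mul_assoc]
      _ = Δ * (S⁻¹ * S) * (S * S⁻¹) * Δ := by rw [← hS2]; simp only [Matrix.mul_assoc]
      _ = Δ * Δ := by rw [hSi, hSi']; simp
  have hQt : Sxyᵀ = T * Aᵀ * Sx - (σ / 2) • A⁻¹ := by
    rw [hQ]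
    simp only [transpose_sub, transpose_mul, transpose_smul, transpose_nonsing_inv,
      transpose_transpose, hTt, hXt, Matrix.mul_assoc]
  have hWM : A⁻¹ * Sx⁻¹ * (Aᵀ)⁻¹ * Aᵀ = A⁻¹ * Sx⁻¹ := by
    rw [Matrix.mul_assoc, hBi', Matrix.mul_one]
  have hfac : Sy = ((T + (σ / 2) • (A⁻¹ * Sx⁻¹ * (Aᵀ)⁻¹)) * Aᵀ) * Sxy := by
    have e : Sy = Δ * Δ - (σ ^ 2 / 4) • (A⁻¹ * Sx⁻¹ * (Aᵀ)⁻¹) := by rw [hΔ2]; simp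
    have h1 : A⁻¹ * Sx⁻¹ * (Sx * A * T) = T := by
      calc _ = A⁻¹ * (Sx⁻¹ * Sx) * A * T := by simp only [Matrix.mul_assoc]
        _ = T := by rw [hXi', Matrix.mul_one, hAi', Matrix.one_mul]
    have h2 : T * Aᵀ * (Sx * A * T) = Δ * Δ := by
      rw [← hTMT]; simp only [Matrix.mul_assoc]
    have h3 : T * Aᵀ * (Aᵀ)⁻¹ = T := by rw [Matrix.mul_assoc, hBi, Matrix.mul_one]
    rw [Matrix.add_mul, Matrix.smul_mul, hWM, hQ, Matrix.add_mul, Matrix.mul_sub, Matrix.mul_sub,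
      Matrix.smul_mul, Matrix.smul_mul, h1, h2, Matrix.mul_smul, Matrix.mul_smul, h3, e, smul_smul]
    have : σ ^ 2 / 4 = σ / 2 * (σ / 2) := by ring
    rw [this]
    abel
  have hQu : IsUnit Sxy.det := by
    have h := hYu
    rw [hfac, det_mul] at h
    exact isUnit_of_mul_isUnit_right h
  have hmain : Sy * Sxy⁻¹ * Sx - Sxyᵀ = σ • A⁻¹ := by
    have h1 : Sy * Sxy⁻¹ = (T + (σ / 2) • (A⁻¹ * Sx⁻¹ * (Aᵀ)⁻¹)) * Aᵀ := by
      conv_lhs => rw [hfac]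
      rw [Matrix.mul_assoc, mul_nonsing_inv _ hQu, Matrix.mul_one]
    rw [h1, hQt, Matrix.add_mul, Matrix.smul_mul, hWM, Matrix.add_mul, Matrix.smul_mul,
      Matrix.mul_assoc A⁻¹, hXi', Matrix.mul_one]
    have : σ • A⁻¹ = (σ / 2) • A⁻¹ + (σ / 2) • A⁻¹ := by rw [← add_smul]; congr 1; ring
    rw [this]
    abel
  have hinv : (σ • A⁻¹) * (σ⁻¹ • A) = 1 := by
    rw [Matrix.smul_mul, Matrix.mul_smul, smul_smul, hAi', mul_inv_cancel₀ hσ.ne', one_smul]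
  refine ⟨hQu, ?_, ?_⟩
  · rw [hmain]
    exact isUnit_det_of_right_inverse hinv
  · rw [hmain, inv_eq_right_inv hinv, smul_smul, mul_inv_cancel₀ hσ.ne', one_smul]
end

section
/- Let n ≥ 1, let A be an invertible n×n real matrix, and let Σ_X and Σ_Y be symmetric positive definite n×n real matrices. For σ > 0 define Δ(σ) = ((σ²/4)·A⁻¹Σ_X⁻¹A⁻* + Σ_Y)^{1/2} and Σ_XY(σ) = Σ_X A Δ(σ)(Δ(σ)A*Σ_X A Δ(σ))^{-1/2}Δ(σ) − (σ/2)A⁻*. Then, as σ → 0 from the right, Σ_XY(σ) converges to Σ_X A Σ_Y^{1/2}(Σ_Y^{1/2}A*Σ_X A Σ_Y^{1/2})^{-1/2}Σ_Y^{1/2}. -/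
open Matrix Classical

/-- The unique positive semidefinite square root of a positive semidefinite
real matrix (junk value `0` if the matrix is not positive semidefinite). -/
noncomputable def psdSqrt {n : ℕ} (M : Matrix (Fin n) (Fin n) ℝ) :
    Matrix (Fin n) (Fin n) ℝ :=
  if h : M.PosSemidef then
    (h.isHermitian.eigenvectorUnitary : Matrix (Fin n) (Fin n) ℝ) *
      diagonal (Real.sqrt ∘ h.isHermitian.eigenvalues) *
      (star h.isHermitian.eigenvectorUnitary : Matrix (Fin n) (Fin n) ℝ)
  else 0

section helpers
open scoped MatrixOrder Matrix.Norms.L2Operator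

theorem psdSqrt_posSemidef {n : ℕ} (M : Matrix (Fin n) (Fin n) ℝ) : (psdSqrt M).PosSemidef := by
  unfold psdSqrt
  split_ifs with h
  · have hd : (diagonal (Real.sqrt ∘ h.isHermitian.eigenvalues)).PosSemidef :=
      PosSemidef.diagonal (fun i => Real.sqrt_nonneg _)
    have := hd.mul_mul_conjTranspose_same
      (h.isHermitian.eigenvectorUnitary : Matrix (Fin n) (Fin n) ℝ)
    simpa [star_eq_conjTranspose] using this
  · exact PosSemidef.zero

theorem psdSqrt_mul_self {n : ℕ} {M : Matrix (Fin n) (Fin n) ℝ} (h : M.PosSemidef) :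
    psdSqrt M * psdSqrt M = M := by
  have hs := h.isHermitian.spectral_theorem
  unfold psdSqrt
  rw [dif_pos h]
  set U := h.isHermitian.eigenvectorUnitary with hU
  have hUU : (star U : Matrix (Fin n) (Fin n) ℝ) * (U : Matrix (Fin n) (Fin n) ℝ) = 1 := by
    exact Unitary.coe_star_mul_self U
  have hD : diagonal (Real.sqrt ∘ h.isHermitian.eigenvalues) *
      diagonal (Real.sqrt ∘ h.isHermitian.eigenvalues) = diagonal h.isHermitian.eigenvalues := by
    rw [diagonal_mul_diagonal]
    congr 1
    funext i
    exact Real.mul_self_sqrt (h.eigenvalues_nonneg i)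
  calc _ = (U : Matrix (Fin n) (Fin n) ℝ) * (diagonal (Real.sqrt ∘ h.isHermitian.eigenvalues) *
        ((star U : Matrix (Fin n) (Fin n) ℝ) * (U : Matrix (Fin n) (Fin n) ℝ)) *
        diagonal (Real.sqrt ∘ h.isHermitian.eigenvalues)) *
        (star U : Matrix (Fin n) (Fin n) ℝ) := by simp only [Matrix.mul_assoc]
    _ = M := by
      rw [hUU, Matrix.mul_one, hD]
      conv_rhs => rw [hs]
      simp [Unitary.conjStarAlgAut_apply]

theorem psdSqrt_eq {n : ℕ} {M : Matrix (Fin n) (Fin n) ℝ} (h : M.PosSemidef) :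
    psdSqrt M = CFC.sqrt M :=
  (CFC.sqrt_unique (psdSqrt_mul_self h)
    (nonneg_iff_posSemidef.2 (psdSqrt_posSemidef M))).symm

theorem psdSqrt_det {n : ℕ} {M : Matrix (Fin n) (Fin n) ℝ} (h : M.PosDef) :
    (psdSqrt M).det ≠ 0 := by
  intro h0
  have := congrArg det (psdSqrt_mul_self h.posSemidef)
  rw [det_mul, h0, zero_mul] at this
  exact h.det_pos.ne this

theorem psdSqrt_continuousOn {n : ℕ} :
    ContinuousOn (psdSqrt : Matrix (Fin n) (Fin n) ℝ → _) {M | M.PosSemidef} := by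
  have h := CFC.continuousOn_sqrt (A := Matrix (Fin n) (Fin n) ℝ)
  have h2 : {M : Matrix (Fin n) (Fin n) ℝ | M.PosSemidef} = {M | 0 ≤ M} := by
    ext M; exact nonneg_iff_posSemidef.symm
  rw [h2]
  exact h.congr (fun M hM => psdSqrt_eq (nonneg_iff_posSemidef.1 hM))
end helpers

theorem psdSqrt_tendsto {n : ℕ} {l : Filter ℝ} {f : ℝ → Matrix (Fin n) (Fin n) ℝ}
    {M : Matrix (Fin n) (Fin n) ℝ} (hf : Filter.Tendsto f l (nhds M))
    (hp : ∀ s, (f s).PosSemidef) (hM : M.PosSemidef) :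
    Filter.Tendsto (fun s => psdSqrt (f s)) l (nhds (psdSqrt M)) :=
  (psdSqrt_continuousOn M hM).tendsto.comp
    (tendsto_nhdsWithin_iff.2 ⟨hf, Filter.Eventually.of_forall hp⟩)

/-- Limit lemma (i) of Bojilov–Galichon: as the heterogeneity
scale `σ → 0⁺`, the closed-form equilibrium cross-covariance
`Sxy(σ) = Sx A Δ(σ) (Δ(σ) Aᵀ Sx A Δ(σ))^{-1/2} Δ(σ) − (σ/2) A⁻ᵀ`, where
`Δ(σ) = ((σ²/4)·A⁻¹Sx⁻¹A⁻ᵀ + Sy)^{1/2}`, converges to the optimal-transport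
solution `Sx A Sy^{1/2} (Sy^{1/2} Aᵀ Sx A Sy^{1/2})^{-1/2} Sy^{1/2}`. -/
theorem stmt9 (n : ℕ) (hn : 1 ≤ n)
    (A Sx Sy : Matrix (Fin n) (Fin n) ℝ)
    (hA : IsUnit A.det) (hX : Sx.PosDef) (hY : Sy.PosDef) :
    Filter.Tendsto
      (fun σ : ℝ =>
        Sx * A * psdSqrt ((σ ^ 2 / 4) • (A⁻¹ * Sx⁻¹ * (Aᵀ)⁻¹) + Sy) *
            (psdSqrt (psdSqrt ((σ ^ 2 / 4) • (A⁻¹ * Sx⁻¹ * (Aᵀ)⁻¹) + Sy) * Aᵀ * Sx * A *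
                psdSqrt ((σ ^ 2 / 4) • (A⁻¹ * Sx⁻¹ * (Aᵀ)⁻¹) + Sy)))⁻¹ *
            psdSqrt ((σ ^ 2 / 4) • (A⁻¹ * Sx⁻¹ * (Aᵀ)⁻¹) + Sy) -
          (σ / 2) • (Aᵀ)⁻¹)
      (nhdsWithin 0 (Set.Ioi 0))
      (nhds (Sx * A * psdSqrt Sy * (psdSqrt (psdSqrt Sy * Aᵀ * Sx * A * psdSqrt Sy))⁻¹ *
        psdSqrt Sy)) := by
  set B := A⁻¹ * Sx⁻¹ * (Aᵀ)⁻¹ with hB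
  have hBp : B.PosSemidef := by
    have := hX.inv.posSemidef.mul_mul_conjTranspose_same A⁻¹
    rwa [conjTranspose_eq_transpose_of_trivial, transpose_nonsing_inv] at this
  have hpd : ∀ s : ℝ, ((s ^ 2 / 4) • B + Sy).PosDef := fun s =>
    PosDef.posSemidef_add (hBp.smul (by positivity)) hY
  have key : ∀ D : Matrix (Fin n) (Fin n) ℝ, D.PosSemidef → (D * Aᵀ * Sx * A * D).PosSemidef := by
    intro D hD
    have := hX.posSemidef.conjTranspose_mul_mul_same (A * D)
    rw [conjTranspose_mul, hD.isHermitian.eq, conjTranspose_eq_transpose_of_trivial] at this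
    simpa only [Matrix.mul_assoc] using this
  have hM : Filter.Tendsto (fun s : ℝ => (s ^ 2 / 4) • B + Sy) (nhdsWithin 0 (Set.Ioi 0))
      (nhds Sy) := by
    have hc : Continuous (fun s : ℝ => (s ^ 2 / 4) • B + Sy) := by fun_prop
    have := hc.tendsto 0
    simp at this
    exact this.mono_left nhdsWithin_le_nhds
  have hD := psdSqrt_tendsto hM (fun s => (hpd s).posSemidef) hY.posSemidef
  have hN := (((hD.mul_const Aᵀ).mul_const Sx).mul_const A).mul hD
  have hS := psdSqrt_tendsto hN (fun s => key _ (psdSqrt_posSemidef _))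
    (key _ (psdSqrt_posSemidef _))
  have hA0 : A.det ≠ 0 := hA.ne_zero
  have hdet : (psdSqrt (psdSqrt Sy * Aᵀ * Sx * A * psdSqrt Sy)).det ≠ 0 := by
    apply psdSqrt_det
    rw [(key _ (psdSqrt_posSemidef _)).posDef_iff_det_ne_zero]
    simp only [det_mul, det_transpose]
    have h1 := psdSqrt_det hY
    have h2 := hX.det_pos.ne'
    positivity
  have hI := (continuousAt_matrix_inv _ (by
    rw [Ring.inverse_eq_inv']
    exact continuousAt_inv₀ hdet)).tendsto.comp hS
  have hlin : Filter.Tendsto (fun s : ℝ => (s / 2) • (Aᵀ)⁻¹) (nhdsWithin 0 (Set.Ioi 0))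
      (nhds 0) := by
    have hc : Continuous (fun s : ℝ => (s / 2) • (Aᵀ)⁻¹) := by fun_prop
    have := hc.tendsto 0
    simp only [zero_div, zero_smul] at this
    exact this.mono_left nhdsWithin_le_nhds
  have := (((hD.const_mul (Sx * A)).mul hI).mul hD).sub hlin
  rw [sub_zero] at this
  exact this
end

section
/- Let n ≥ 1, let Σ be a symmetric positive definite 2n×2n real matrix with n×n blocks Σ_X (top-left), Σ_XY (top-right), Σ_XY* (bottom-left), Σ_Y (bottom-right). Define for x, y ∈ ℝⁿ the joint density f(x,y) = ((2π)^{2n} det Σ)^{-1/2} exp(−(1/2)·(x,y)ᵀΣ⁻¹(x,y)) and the marginal density g(x) = ((2π)ⁿ det Σ_X)^{-1/2} exp(−(1/2)·xᵀΣ_X⁻¹x). Then for every i, j ∈ {1,…,n} and every (x,y) ∈ ℝⁿ×ℝⁿ, the mixed second partial derivative ∂²/∂x_i ∂y_j of log(f(x,y)/g(x)) exists and equals the (i,j) entry of the constant matrix Σ_X⁻¹Σ_XY(Σ_Y − Σ_XY*Σ_X⁻¹Σ_XY)⁻¹. -/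
open Matrix Real

theorem aux_inv {n : ℕ} (Sx Sy Sxy : Matrix (Fin n) (Fin n) ℝ)
    (hSig : (fromBlocks Sx Sxy Sxyᵀ Sy).PosDef) (hx : Sx.PosDef) (i j : Fin n) :
    (fromBlocks Sx Sxy Sxyᵀ Sy)⁻¹ (Sum.inl i) (Sum.inr j) =
      -((Sx⁻¹ * Sxy * (Sy - Sxyᵀ * Sx⁻¹ * Sxy)⁻¹) i j) := by
  let : Invertible Sx := hx.isUnit.invertible
  let : Invertible (fromBlocks Sx Sxy Sxyᵀ Sy) := hSig.isUnit.invertible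
  let : Invertible (Sy - Sxyᵀ * ⅟Sx * Sxy) :=
    invertibleOfFromBlocks₁₁Invertible Sx Sxy Sxyᵀ Sy
  rw [← invOf_eq_nonsing_inv, invOf_fromBlocks₁₁_eq]
  simp [invOf_eq_nonsing_inv]

theorem aux_poly {n : ℕ} (P : Matrix (Fin n ⊕ Fin n) (Fin n ⊕ Fin n) ℝ) (hP : P.IsHermitian)
    (i j : Fin n) (x y : Fin n → ℝ) :
    ∃ (A : ℝ → ℝ) (B E : ℝ), ∀ s t : ℝ,
      Sum.elim (Function.update x i s) (Function.update y j t) ⬝ᵥ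
        (P *ᵥ Sum.elim (Function.update x i s) (Function.update y j t)) =
      A s + (B + s * (2 * P (Sum.inl i) (Sum.inr j))) * t + E * t ^ 2 := by
  set a : Fin n ⊕ Fin n → ℝ := Pi.single (Sum.inl i) 1 with ha
  set b : Fin n ⊕ Fin n → ℝ := Pi.single (Sum.inr j) 1 with hb
  set w : Fin n ⊕ Fin n → ℝ :=
    Sum.elim (Function.update x i 0) (Function.update y j 0) with hw
  have key : ∀ s t : ℝ, Sum.elim (Function.update x i s) (Function.update y j t)
      = w + s • a + t • b := by
    intro s t
    ext k
    rcases k with k | k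
    · by_cases h : k = i
      · subst h; simp only [hw, ha, hb, Pi.add_apply, Pi.smul_apply, Sum.elim_inl, Sum.elim_inr, Function.update_self, Pi.single_apply]; simp
      · simp only [hw, ha, hb, Pi.add_apply, Pi.smul_apply, Sum.elim_inl, Sum.elim_inr,
          Function.update_of_ne h, Pi.single_apply]
        simp [h]
    · by_cases h : k = j
      · subst h; simp only [hw, ha, hb, Pi.add_apply, Pi.smul_apply, Sum.elim_inl, Sum.elim_inr, Function.update_self, Pi.single_apply]; simp
      · simp only [hw, ha, hb, Pi.add_apply, Pi.smul_apply, Sum.elim_inl, Sum.elim_inr,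
          Function.update_of_ne h, Pi.single_apply]
        simp [h]
  have hab : a ⬝ᵥ (P *ᵥ b) = P (Sum.inl i) (Sum.inr j) := by
    simp [ha, hb]
  have hba : b ⬝ᵥ (P *ᵥ a) = P (Sum.inl i) (Sum.inr j) := by
    have := hP.apply (Sum.inl i) (Sum.inr j)
    simp at this
    simp [ha, hb, this]
  refine ⟨fun s => (w + s • a) ⬝ᵥ (P *ᵥ (w + s • a)), w ⬝ᵥ (P *ᵥ b) + b ⬝ᵥ (P *ᵥ w),
    b ⬝ᵥ (P *ᵥ b), fun s t => ?_⟩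
  rw [key]
  simp only [mulVec_add, mulVec_smul, add_dotProduct, dotProduct_add, smul_dotProduct,
    dotProduct_smul, smul_eq_mul, hab, hba]
  ring

/-- For a jointly Gaussian density `f` on `ℝⁿ × ℝⁿ` with
positive definite block covariance `Σ = fromBlocks Sx Sxy Sxyᵀ Sy` and Gaussian
marginal density `g` with covariance `Sx`, the mixed second partial derivative
`∂²/∂xᵢ∂yⱼ log (f(x,y)/g(x))` exists at every point and equals the `(i,j)`
entry of the constant matrix `Sx⁻¹ Sxy (Sy − Sxyᵀ Sx⁻¹ Sxy)⁻¹`. -/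
theorem stmt12 (n : ℕ) (hn : 1 ≤ n)
    (Sx Sy Sxy : Matrix (Fin n) (Fin n) ℝ)
    (hSig : (fromBlocks Sx Sxy Sxyᵀ Sy).PosDef)
    (f : (Fin n → ℝ) → (Fin n → ℝ) → ℝ)
    (hf : f = fun x y =>
      (Real.sqrt ((2 * π) ^ (2 * n) * (fromBlocks Sx Sxy Sxyᵀ Sy).det))⁻¹ *
        Real.exp (-(1 / 2) *
          (Sum.elim x y ⬝ᵥ ((fromBlocks Sx Sxy Sxyᵀ Sy)⁻¹ *ᵥ Sum.elim x y))))
    (g : (Fin n → ℝ) → ℝ)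
    (hg : g = fun x =>
      (Real.sqrt ((2 * π) ^ n * Sx.det))⁻¹ *
        Real.exp (-(1 / 2) * (x ⬝ᵥ (Sx⁻¹ *ᵥ x))))
    (i j : Fin n) (x y : Fin n → ℝ) :
    (∀ s : ℝ, DifferentiableAt ℝ
        (fun t : ℝ =>
          Real.log (f (Function.update x i s) (Function.update y j t) /
            g (Function.update x i s))) (y j)) ∧
      HasDerivAt
        (fun s : ℝ => deriv
          (fun t : ℝ =>
            Real.log (f (Function.update x i s) (Function.update y j t) /
              g (Function.update x i s))) (y j))
        ((Sx⁻¹ * Sxy * (Sy - Sxyᵀ * Sx⁻¹ * Sxy)⁻¹) i j) (x i) := by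
  have hx : Sx.PosDef := by
    have := hSig.submatrix (e := (Sum.inl : Fin n → Fin n ⊕ Fin n)) Sum.inl_injective
    exact this
  obtain ⟨A, B, E, hQ⟩ := aux_poly _ hSig.isHermitian.inv i j x y
  rw [aux_inv Sx Sy Sxy hSig hx i j] at hQ
  set D := (Sx⁻¹ * Sxy * (Sy - Sxyᵀ * Sx⁻¹ * Sxy)⁻¹) i j with hD
  have hc : (Real.sqrt ((2 * π) ^ (2 * n) * (fromBlocks Sx Sxy Sxyᵀ Sy).det))⁻¹ ≠ 0 := by
    have := hSig.det_pos
    positivity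
  have hc' : (Real.sqrt ((2 * π) ^ n * Sx.det))⁻¹ ≠ 0 := by
    have := hx.det_pos
    positivity
  set c := (Real.sqrt ((2 * π) ^ (2 * n) * (fromBlocks Sx Sxy Sxyᵀ Sy).det))⁻¹
  set c' := (Real.sqrt ((2 * π) ^ n * Sx.det))⁻¹
  obtain ⟨K, hK⟩ : ∃ K : ℝ → ℝ, ∀ s t : ℝ,
      Real.log (f (Function.update x i s) (Function.update y j t) /
            g (Function.update x i s)) = K s + (-B / 2 + s * D) * t + (-E / 2) * t ^ 2 := by
    refine ⟨fun s => Real.log c - (1 / 2) * A s - Real.log c' + (1 / 2) *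
      (Function.update x i s ⬝ᵥ (Sx⁻¹ *ᵥ Function.update x i s)), fun s t => ?_⟩
    rw [hf, hg]
    simp only
    rw [Real.log_div (mul_ne_zero hc (Real.exp_ne_zero _)) (mul_ne_zero hc' (Real.exp_ne_zero _)),
      Real.log_mul hc (Real.exp_ne_zero _), Real.log_mul hc' (Real.exp_ne_zero _),
      Real.log_exp, Real.log_exp, hQ]
    ring
  simp only [hK]
  have hd : ∀ s : ℝ, HasDerivAt (fun t : ℝ => K s + (-B / 2 + s * D) * t + (-E / 2) * t ^ 2)
      (-B / 2 + s * D - E * y j) (y j) := by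
    intro s
    have h := (((hasDerivAt_id (y j)).const_mul (-B / 2 + s * D)).const_add (K s)).add
      (((hasDerivAt_id (y j)).pow 2).const_mul (-E / 2))
    refine HasDerivAt.congr_deriv h ?_
    simp
    ring
  refine ⟨fun s => (hd s).differentiableAt, ?_⟩
  simp only [fun s => (hd s).deriv]
  have h := (((hasDerivAt_id (x i)).mul_const D).const_add (-B / 2)).sub_const (E * y j)
  simpa using h
end

section
/- Let n ≥ 1, let Σ_X and Σ_Y be n×n real matrices, let σ > 0, and let M₀ be an invertible n×n real matrix such that Σ_Y M₀⁻¹Σ_X − M₀* is invertible. Define F on n×n real matrices by F(M) = σ·(Σ_Y M⁻¹Σ_X − M*)⁻¹, and set A = F(M₀). Then F is Fréchet differentiable at M₀ with derivative given by the linear map H ↦ (1/σ)·A·(Σ_Y M₀⁻¹ H M₀⁻¹ Σ_X + H*)·A. -/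
theorem aux_ring {R : Type*} [NormedRing R] [NormedAlgebra ℝ R] [CompleteSpace R]
    (a b : R) (σ : ℝ) (T : R →L[ℝ] R) (m : R) (hm : IsUnit m)
    (hi : IsUnit (a * Ring.inverse m * b - T m)) :
    ∃ L : R →L[ℝ] R,
      HasFDerivAt (fun x : R => σ • Ring.inverse (a * Ring.inverse x * b - T x)) L m ∧
      ∀ H, L H = σ • (Ring.inverse (a * Ring.inverse m * b - T m) *
        (a * Ring.inverse m * H * Ring.inverse m * b + T H) *
        Ring.inverse (a * Ring.inverse m * b - T m)) := by
  obtain ⟨u, rfl⟩ := hm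
  obtain ⟨v, hv⟩ := hi
  have h₁ := hasFDerivAt_ringInverse (𝕜 := ℝ) u
  have h₂ := hasFDerivAt_ringInverse (𝕜 := ℝ) v
  have hG := ((h₁.const_mul a).mul_const' b).sub (T.hasFDerivAt (x := (u : R)))
  rw [hv] at h₂
  have hc := (HasFDerivAt.comp (u : R) (f := fun x : R =>
    a * Ring.inverse x * b - T x) h₂ hG).const_smul σ
  refine ⟨_, hc, fun H => ?_⟩
  rw [← hv]
  simp
  noncomm_ring
  rw [smul_add]

section aux
attribute [local instance] Matrix.linftyOpNormedRing Matrix.linftyOpNormedAlgebra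

theorem aux_main (n : ℕ)
    (Sx Sy : Matrix (Fin n) (Fin n) ℝ) (σ : ℝ)
    (M₀ : Matrix (Fin n) (Fin n) ℝ) (hM₀ : IsUnit M₀.det)
    (hinv : IsUnit (Sy * M₀⁻¹ * Sx - M₀.transpose).det) :
    ∃ L : Matrix (Fin n) (Fin n) ℝ →L[ℝ] Matrix (Fin n) (Fin n) ℝ,
      HasFDerivAt (fun M : Matrix (Fin n) (Fin n) ℝ =>
        σ • (Sy * M⁻¹ * Sx - M.transpose)⁻¹) L M₀ ∧
      ∀ H, L H = σ • ((Sy * M₀⁻¹ * Sx - M₀.transpose)⁻¹ *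
        (Sy * M₀⁻¹ * H * M₀⁻¹ * Sx + H.transpose) *
        (Sy * M₀⁻¹ * Sx - M₀.transpose)⁻¹) := by
  let T : Matrix (Fin n) (Fin n) ℝ →L[ℝ] Matrix (Fin n) (Fin n) ℝ :=
    LinearMap.toContinuousLinearMap
      (Matrix.transposeLinearEquiv (Fin n) (Fin n) ℝ ℝ).toLinearMap
  rw [← Matrix.isUnit_iff_isUnit_det] at hM₀ hinv
  simp only [Matrix.nonsing_inv_eq_ringInverse] at hinv ⊢
  haveI : CompleteSpace (Matrix (Fin n) (Fin n) ℝ) := FiniteDimensional.complete ℝ _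
  exact aux_ring Sy Sx σ T M₀ hM₀ hinv
end aux

open Matrix

attribute [local instance] Matrix.normedAddCommGroup Matrix.normedSpace

/-- Theorem 3(i), formula (cs1) of Bojilov–Galichon in
non-vectorized form: the identification map `F(M) = σ·(Sy M⁻¹ Sx − Mᵀ)⁻¹` is
Fréchet differentiable at an invertible `M₀` (with `Sy M₀⁻¹ Sx − M₀ᵀ`
invertible), with derivative `H ↦ (1/σ)·A·(Sy M₀⁻¹ H M₀⁻¹ Sx + Hᵀ)·A`, where
`A = F(M₀)`. -/
theorem stmt13 (n : ℕ) (hn : 1 ≤ n)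
    (Sx Sy : Matrix (Fin n) (Fin n) ℝ) (σ : ℝ) (hσ : 0 < σ)
    (M₀ : Matrix (Fin n) (Fin n) ℝ) (hM₀ : IsUnit M₀.det)
    (hinv : IsUnit (Sy * M₀⁻¹ * Sx - M₀ᵀ).det)
    (F : Matrix (Fin n) (Fin n) ℝ → Matrix (Fin n) (Fin n) ℝ)
    (hF : F = fun M => σ • (Sy * M⁻¹ * Sx - Mᵀ)⁻¹)
    (A : Matrix (Fin n) (Fin n) ℝ) (hA : A = F M₀) :
    DifferentiableAt ℝ F M₀ ∧
      ∀ H : Matrix (Fin n) (Fin n) ℝ,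
        fderiv ℝ F M₀ H = (1 / σ) • (A * (Sy * M₀⁻¹ * H * M₀⁻¹ * Sx + Hᵀ) * A) := by
  subst hF
  obtain ⟨L, hL, e⟩ := aux_main n Sx Sy σ M₀ hM₀ hinv
  have hL' : HasFDerivAt (fun M : Matrix (Fin n) (Fin n) ℝ =>
        σ • (Sy * M⁻¹ * Sx - Mᵀ)⁻¹) L M₀ := hL
  refine ⟨hL'.differentiableAt, fun H => ?_⟩
  rw [hL'.fderiv]
  refine (e H).trans ?_
  subst hA
  simp only [Matrix.smul_mul, Matrix.mul_smul, smul_smul]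
  congr 1
  field_simp
end
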